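/- Let p_n ∈ ℤ[z] be defined by p_0 = 0 and p_{n+1} = p_n^2 + z, and for ℓ, n ∈ ℕ set q_{ℓ,n} = p_{ℓ+n} − p_ℓ. For every ℓ ≥ 2 and n ≥ 1, the cardinality of mis(ℓ,n) satisfies |mis(ℓ,n)| = Φ(ℓ,n) · |hyp(n)|, where Φ(ℓ,n) = 2^{ℓ−1} − 1 if n divides ℓ−1 and Φ(ℓ,n) = 2^{ℓ−1} otherwise. -/

import Mathlib

open Polynomial

/-- The polynomials `p n` defined by `p 0 = 0`, `p (n+1) = p n ^ 2 + X`. -/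
noncomputable def P : ℕ → Polynomial ℤ
  | 0 => 0
  | n + 1 => P n ^ 2 + X

/-- The Misiurewicz–Thurston polynomials `q l n = p (l + n) - p l`. -/
noncomputable def Q (l n : ℕ) : Polynomial ℤ := P (l + n) - P l

/-- `p n` viewed over `ℂ`. -/
noncomputable def pC (n : ℕ) : Polynomial ℂ := (P n).map (Int.castRingHom ℂ)

/-- `q l n` viewed over `ℂ`. -/
noncomputable def qC (l n : ℕ) : Polynomial ℂ := (Q l n).map (Int.castRingHom ℂ)

/-- Hyperbolic centers of order `n`: roots of `p n` that are not roots of `p k`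
for any strict divisor `k` of `n`. -/
def hyp (n : ℕ) : Set ℂ :=
  {z | (pC n).eval z = 0 ∧ ∀ k : ℕ, k ∣ n → k ≠ n → (pC k).eval z ≠ 0}

/-- Misiurewicz points of type `(l, n)`. -/
def mis (l n : ℕ) : Set ℂ :=
  {z | (qC l n).eval z = 0 ∧ (qC (l - 1) n).eval z ≠ 0 ∧
    ∀ k : ℕ, k ∣ n → k ≠ n → (qC l k).eval z ≠ 0}

/-- Gleason's polynomial `h n = ∏_{r ∈ hyp n} (X - r)`. -/
noncomputable def hPoly (n : ℕ) : Polynomial ℂ := ∏ᶠ r ∈ hyp n, (X - C r)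

/-- Reduced Misiurewicz polynomial `m l n = ∏_{r ∈ mis l n} (X - r)`. -/
noncomputable def mPoly (l n : ℕ) : Polynomial ℂ := ∏ᶠ r ∈ mis l n, (X - C r)

/-- The multiplicity `η l k = ⌊(l - 1)/k⌋ + 2`, with the conventions
`η 0 k = 1` (floor taken in `ℤ`) and `η 1 k = 2`. -/
def eta (l k : ℕ) : ℕ := if l = 0 then 1 else (l - 1) / k + 2

open Function

/-- The quadratic map `w ↦ w ^ 2 + z`. -/
def quadMap (z w : ℂ) : ℂ := w ^ 2 + z

lemma eval_pC_succ (n : ℕ) (z : ℂ) :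
    (pC (n + 1)).eval z = (pC n).eval z ^ 2 + z := by
  simp [pC, P]

lemma eval_pC (n : ℕ) (z : ℂ) : (pC n).eval z = (quadMap z)^[n] 0 := by
  induction n with
  | zero => simp [pC, P]
  | succ n ih => rw [eval_pC_succ, ih, iterate_succ_apply', quadMap]

lemma eval_pC_eq_zero_iff (n : ℕ) (z : ℂ) :
    (pC n).eval z = 0 ↔ minimalPeriod (quadMap z) 0 ∣ n := by
  rw [← isPeriodicPt_iff_minimalPeriod_dvd, eval_pC, IsPeriodicPt, IsFixedPt]

lemma eval_qC (l n : ℕ) (z : ℂ) :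
    (qC l n).eval z = (pC (l + n)).eval z - (pC l).eval z := by
  simp [qC, Q, pC]

lemma eval_qC_eq_zero_iff (l n : ℕ) (z : ℂ) :
    (qC l n).eval z = 0 ↔ minimalPeriod (quadMap z) ((quadMap z)^[l] 0) ∣ n := by
  rw [← isPeriodicPt_iff_minimalPeriod_dvd, eval_qC, eval_pC, eval_pC, sub_eq_zero,
    IsPeriodicPt, IsFixedPt, ← iterate_add_apply, add_comm n l]

lemma dvd_and_forall_strict_divisor_iff {m n : ℕ} :
    (m ∣ n ∧ ∀ k, k ∣ n → k ≠ n → ¬ m ∣ k) ↔ m = n := by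
  constructor
  · rintro ⟨h, h'⟩
    by_contra hne
    exact h' m h hne dvd_rfl
  · rintro rfl
    exact ⟨dvd_rfl, fun k hk hne h => hne (Nat.dvd_antisymm hk h)⟩

lemma mem_hyp_iff (n : ℕ) (z : ℂ) : z ∈ hyp n ↔ minimalPeriod (quadMap z) 0 = n := by
  simp only [hyp, Set.mem_ofPred_eq, ne_eq, eval_pC_eq_zero_iff]
  exact dvd_and_forall_strict_divisor_iff

lemma mem_mis_iff (l n : ℕ) (z : ℂ) :
    z ∈ mis l n ↔ minimalPeriod (quadMap z) ((quadMap z)^[l] 0) = n ∧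
      ¬ minimalPeriod (quadMap z) ((quadMap z)^[l - 1] 0) ∣ n := by
  rw [← dvd_and_forall_strict_divisor_iff]
  simp only [mis, Set.mem_ofPred_eq, ne_eq, eval_qC_eq_zero_iff]
  tauto

lemma monic_P_and_natDegree (n : ℕ) :
    (P (n + 1)).Monic ∧ (P (n + 1)).natDegree = 2 ^ n := by
  induction n with
  | zero => simp [P, monic_X]
  | succ n ih =>
    obtain ⟨hm, hd⟩ := ih
    have hd2 : (P (n + 1) ^ 2).natDegree = 2 ^ (n + 1) := by
      rw [hm.natDegree_pow, hd, pow_succ, mul_comm]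
    have hlt : (X : ℤ[X]).natDegree < (P (n + 1) ^ 2).natDegree := by
      rw [hd2, natDegree_X]
      exact Nat.one_lt_two_pow (Nat.succ_ne_zero n)
    rw [P]
    exact ⟨(hm.pow 2).add_of_left (degree_lt_degree hlt),
      by rw [natDegree_add_eq_left_of_natDegree_lt hlt, hd2]⟩

/-- The complementary factor in `Q (l + 1) n = Q l n * S l n`. -/
noncomputable def S (l n : ℕ) : ℤ[X] := P (l + n) + P l

lemma monic_S_and_natDegree {l n : ℕ} (hl : 1 ≤ l) (hn : 1 ≤ n) :
    (S l n).Monic ∧ (S l n).natDegree = 2 ^ (l + n - 1) := by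
  obtain ⟨l, rfl⟩ := Nat.exists_eq_add_of_le' hl
  have h1 := monic_P_and_natDegree l
  have h2 := monic_P_and_natDegree (l + n)
  have hlt : (P (l + 1)).natDegree < (P (l + n + 1)).natDegree := by
    rw [h1.2, h2.2]
    exact Nat.pow_lt_pow_right one_lt_two (by omega)
  rw [S, show l + 1 + n = l + n + 1 by ring]
  exact ⟨h2.1.add_of_left (degree_lt_degree hlt),
    by rw [natDegree_add_eq_left_of_natDegree_lt hlt, h2.2]; simp⟩

lemma not_isIntegral_of_two_mul_eq_one {x : ℂ} (h : 2 * x = 1) : ¬ IsIntegral ℤ x := by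
  intro hx
  have h2 : x = algebraMap ℚ ℂ (1 / 2) := by
    simp only [map_div₀, map_one, map_ofNat]
    linear_combination h / 2
  rw [h2, isIntegral_algebraMap_iff (algebraMap ℚ ℂ).injective,
    IsIntegrallyClosed.isIntegral_iff] at hx
  obtain ⟨y, hy⟩ := hx
  have h3 : ((2 * y : ℤ) : ℚ) = (1 : ℤ) := by
    push_cast
    simp only [eq_intCast] at hy
    rw [hy]; norm_num
  have := Int.cast_injective h3
  omega

/-- A monic integer polynomial `f` whose derivative is a nonzero constant times `g`, where `f` and
`g` generate the unit ideal modulo `2`, has only simple complex roots. -/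
lemma ncard_roots_of_combination {f g a b d : ℤ[X]} {c : ℤ} (hf : f.Monic) (hc : c ≠ 0)
    (hfg : derivative f = C c * g) (h : a * f + b * g + 2 * d = 1) :
    {z : ℂ | aeval z f = 0}.ncard = f.natDegree := by
  have hf0 : f.map (algebraMap ℤ ℂ) ≠ 0 := (hf.map _).ne_zero
  have hset : {z : ℂ | aeval z f = 0} = (f.map (algebraMap ℤ ℂ)).roots.toFinset := by
    ext z
    rw [Finset.mem_coe, Multiset.mem_toFinset, mem_roots hf0, IsRoot, eval_map, ← aeval_def]
    rfl
  have hnodup : (f.map (algebraMap ℤ ℂ)).roots.Nodup := by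
    rw [Multiset.nodup_iff_count_le_one]
    intro z
    rw [count_roots]
    by_contra! hz
    obtain ⟨h1, h2⟩ := (one_lt_rootMultiplicity_iff_isRoot hf0).1 hz
    have e1 : aeval z f = 0 := by simpa [IsRoot, aeval_def, eval_map] using h1
    have e2 : aeval z (derivative f) = 0 := by
      simpa [IsRoot, aeval_def, eval_map, derivative_map] using h2
    have e3 : aeval z g = 0 := by
      rw [hfg] at e2
      simpa [hc] using e2
    have e4 : 2 * aeval z d = 1 := by
      have := congrArg (aeval z) h
      simpa [e1, e3, map_ofNat (aeval (R := ℤ) z) 2] using this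
    have hz' : IsIntegral ℤ z := ⟨f, hf, by rwa [aeval_def] at e1⟩
    refine not_isIntegral_of_two_mul_eq_one e4 ?_
    exact (IsIntegral.of_mem_of_fg _ hz'.fg_adjoin_singleton _ (aeval_mem_adjoin_singleton ℤ z))
  rw [hset, Set.ncard_coe_finset, Multiset.toFinset_card_of_nodup hnodup,
    ← (IsAlgClosed.splits (f.map (algebraMap ℤ ℂ))).natDegree_eq_card_roots, hf.natDegree_map]

lemma derivative_P_succ (n : ℕ) :
    derivative (P (n + 1)) = 1 + 2 * (P n * derivative (P n)) := by
  simp [P, pow_two]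
  ring

lemma eval_pC_eq_aeval (n : ℕ) (z : ℂ) : (pC n).eval z = aeval z (P n) := by
  rw [pC, eval_map, aeval_def]; rfl

lemma ncard_roots_pC {n : ℕ} (hn : 1 ≤ n) :
    {z : ℂ | (pC n).eval z = 0}.ncard = 2 ^ (n - 1) := by
  obtain ⟨n, rfl⟩ := Nat.exists_eq_add_of_le' hn
  simp only [eval_pC_eq_aeval]
  rw [ncard_roots_of_combination (a := 0) (b := 1) (d := -(P n * derivative (P n)))
    (monic_P_and_natDegree n).1 one_ne_zero (by simp; rfl) (by rw [derivative_P_succ]; ring),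
    (monic_P_and_natDegree n).2, Nat.add_sub_cancel]

lemma ncard_roots_S {l n : ℕ} (hl : 1 ≤ l) (hn : 1 ≤ n) :
    {z : ℂ | (pC (l + n)).eval z + (pC l).eval z = 0}.ncard = 2 ^ (l + n - 1) := by
  have hS := monic_S_and_natDegree hl hn
  obtain ⟨l, rfl⟩ := Nat.exists_eq_add_of_le' hl
  obtain ⟨n, rfl⟩ := Nat.exists_eq_add_of_le' hn
  have heq : {z : ℂ | (pC (l + 1 + (n + 1))).eval z + (pC (l + 1)).eval z = 0} =
      {z : ℂ | aeval z (S (l + 1) (n + 1)) = 0} := by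
    simp only [eval_pC_eq_aeval, S, map_add]
  obtain ⟨v, hv⟩ : ∃ v, P l * derivative (P l) = P l + 2 * v := by
    cases l with
    | zero => exact ⟨0, by simp [P]⟩
    | succ l => exact ⟨P (l + 1) * (P l * derivative (P l)), by rw [derivative_P_succ]; ring⟩
  obtain ⟨w, hw⟩ : ∃ w, P (l + n + 1) * derivative (P (l + n + 1)) = P (l + n + 1) + 2 * w :=
    ⟨P (l + n + 1) * (P (l + n) * derivative (P (l + n))), by rw [derivative_P_succ]; ring⟩
  have hder : derivative (S (l + 1) (n + 1)) =
      C 2 * (1 + P l + P (l + n + 1) + 2 * (v + w)) := by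
    rw [S, show l + 1 + (n + 1) = l + n + 1 + 1 by ring, derivative_add, derivative_P_succ (l + n + 1),
      derivative_P_succ l, hv, hw]
    simp only [map_ofNat]
    ring
  have hval : S (l + 1) (n + 1) = P (l + n + 1) ^ 2 + P l ^ 2 + 2 * X := by
    rw [S, show l + 1 + (n + 1) = l + n + 1 + 1 by ring, P.eq_2 (l + n + 1), P.eq_2 l]
    ring
  rw [heq, ncard_roots_of_combination (a := 1) (b := 1 - P (l + n + 1) - P l)
    (d := P (l + n + 1) * P l - X - (v + w) * (1 - P (l + n + 1) - P l))
    hS.1 two_ne_zero hder ?_, hS.2]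
  rw [hval]
  ring

lemma ncard_eq_sum_fibers {s : Set ℂ} (hs : s.Finite) (g : ℂ → ℕ) (D : Finset ℕ)
    (h : ∀ z ∈ s, g z ∈ D) : s.ncard = ∑ k ∈ D, {z | z ∈ s ∧ g z = k}.ncard := by
  classical
  rw [Set.ncard_eq_toFinset_card s hs,
    Finset.card_eq_sum_card_fiberwise (f := g) (t := D) fun z hz => h z (by simpa using hz)]
  refine Finset.sum_congr rfl fun k _ => ?_
  rw [← Set.ncard_coe_finset]
  congr 1
  ext z
  simp

lemma sum_divisors_ncard_hyp {n : ℕ} (hn : 1 ≤ n) :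
    ∑ k ∈ n.divisors, (hyp k).ncard = 2 ^ (n - 1) := by
  rw [← ncard_roots_pC hn, ncard_eq_sum_fibers
    (Set.finite_of_ncard_ne_zero (by rw [ncard_roots_pC hn]; positivity))
    (fun z => minimalPeriod (quadMap z) 0) n.divisors]
  · refine Finset.sum_congr rfl fun k hk => congrArg _ ?_
    ext z
    simp only [Set.mem_ofPred_eq, mem_hyp_iff, eval_pC_eq_zero_iff]
    exact ⟨fun h => ⟨h ▸ Nat.dvd_of_mem_divisors hk, h⟩, fun h => h.2⟩
  · intro z hz
    exact Nat.mem_divisors.2 ⟨(eval_pC_eq_zero_iff n z).1 hz, by omega⟩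

lemma minimalPeriod_succ_of_dvd {z : ℂ} {l n : ℕ} (hn : 1 ≤ n)
    (h : minimalPeriod (quadMap z) ((quadMap z)^[l] 0) ∣ n) :
    minimalPeriod (quadMap z) ((quadMap z)^[l + 1] 0) =
      minimalPeriod (quadMap z) ((quadMap z)^[l] 0) := by
  rw [iterate_succ_apply']
  exact minimalPeriod_apply (mk_mem_periodicPts hn (isPeriodicPt_iff_minimalPeriod_dvd.2 h))

lemma eval_qC_succ (l n : ℕ) (z : ℂ) : (qC (l + 1) n).eval z =
    (qC l n).eval z * ((pC (l + n)).eval z + (pC l).eval z) := by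
  rw [eval_qC, eval_qC, show l + 1 + n = l + n + 1 by ring, eval_pC_succ, eval_pC_succ]
  ring

lemma add_eq_zero_and_eval_qC_eq_zero_iff (l n : ℕ) (z : ℂ) :
    ((pC (l + n)).eval z + (pC l).eval z = 0 ∧ (qC l n).eval z = 0) ↔
      minimalPeriod (quadMap z) 0 ∣ n ∧ minimalPeriod (quadMap z) 0 ∣ l := by
  have : ((pC (l + n)).eval z + (pC l).eval z = 0 ∧ (qC l n).eval z = 0) ↔
      ((pC (l + n)).eval z = 0 ∧ (pC l).eval z = 0) := by
    rw [eval_qC]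
    constructor
    · rintro ⟨h1, h2⟩
      exact ⟨by linear_combination (h1 + h2) / 2, by linear_combination (h1 - h2) / 2⟩
    · rintro ⟨h1, h2⟩
      simp [h1, h2]
  rw [this, eval_pC_eq_zero_iff, eval_pC_eq_zero_iff]
  exact and_congr_left fun h => Nat.dvd_add_right h

lemma mem_mis_succ_iff {l n k : ℕ} (hn : 1 ≤ n) (hk : k ∣ n) (z : ℂ) :
    z ∈ mis (l + 1) k ↔ ((pC (l + n)).eval z + (pC l).eval z = 0 ∧ (qC l n).eval z ≠ 0) ∧
      minimalPeriod (quadMap z) ((quadMap z)^[l + 1] 0) = k := by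
  rw [mem_mis_iff, Nat.add_sub_cancel]
  constructor
  · rintro ⟨h1, h2⟩
    have h3 : (qC l n).eval z ≠ 0 := fun h3 => by
      rw [eval_qC_eq_zero_iff] at h3
      rw [← minimalPeriod_succ_of_dvd hn h3, h1] at h2
      exact h2 dvd_rfl
    have h4 : (qC (l + 1) n).eval z = 0 := by
      rw [eval_qC_eq_zero_iff, h1]
      exact hk
    rw [eval_qC_succ] at h4
    exact ⟨⟨(mul_eq_zero.1 h4).resolve_left h3, h3⟩, h1⟩
  · rintro ⟨⟨-, h2⟩, h3⟩
    exact ⟨h3, fun h => h2 ((eval_qC_eq_zero_iff l n z).2 (h.trans hk))⟩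

lemma sum_divisors_ncard_mis {l n : ℕ} (hl : 1 ≤ l) (hn : 1 ≤ n) :
    ∑ k ∈ n.divisors, ((mis (l + 1) k).ncard + if k ∣ l then (hyp k).ncard else 0) =
      2 ^ (l + n - 1) := by
  have hfin : {z : ℂ | (pC (l + n)).eval z + (pC l).eval z = 0}.Finite :=
    Set.finite_of_ncard_ne_zero (by rw [ncard_roots_S hl hn]; positivity)
  rw [← ncard_roots_S hl hn, Finset.sum_add_distrib, ← Finset.sum_filter,
    ← Set.ncard_inter_add_ncard_sdiff_eq_ncard _ {z : ℂ | (qC l n).eval z = 0} hfin,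
    add_comm (Set.ncard _)]
  congr 1
  · rw [ncard_eq_sum_fibers (hfin.sdiff)
      (fun z => minimalPeriod (quadMap z) ((quadMap z)^[l + 1] 0)) n.divisors]
    · refine Finset.sum_congr rfl fun k hk => congrArg _ ?_
      ext z
      exact mem_mis_succ_iff hn (Nat.dvd_of_mem_divisors hk) z
    · intro z hz
      refine Nat.mem_divisors.2 ⟨(eval_qC_eq_zero_iff _ _ _).1 ?_, by omega⟩
      rw [eval_qC_succ, hz.1, mul_zero]
  · rw [ncard_eq_sum_fibers (hfin.inter_of_left _)
      (fun z => minimalPeriod (quadMap z) 0) (n.divisors.filter (· ∣ l))]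
    · refine Finset.sum_congr rfl fun k hk => congrArg _ ?_
      ext z
      rw [Finset.mem_filter, Nat.mem_divisors] at hk
      rw [mem_hyp_iff]
      refine ⟨fun h => ⟨(add_eq_zero_and_eval_qC_eq_zero_iff l n z).2 ?_, h⟩, fun h => h.2⟩
      rw [h]
      exact ⟨hk.1.1, hk.2⟩
    · intro z hz
      have := (add_eq_zero_and_eval_qC_eq_zero_iff l n z).1 hz
      exact Finset.mem_filter.2 ⟨Nat.mem_divisors.2 ⟨this.1, by omega⟩, this.2⟩

lemma eq_of_sum_divisors_eq {F G : ℕ → ℕ}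
    (h : ∀ n, 1 ≤ n → ∑ k ∈ n.divisors, F k = ∑ k ∈ n.divisors, G k) (n : ℕ) (hn : 1 ≤ n) :
    F n = G n := by
  induction n using Nat.strong_induction_on with
  | _ n ih =>
    have := h n hn
    rw [← Nat.cons_self_properDivisors (by omega), Finset.sum_cons, Finset.sum_cons,
      Finset.sum_congr rfl fun k hk => ih k (Nat.mem_properDivisors.1 hk).2
        (Nat.pos_of_mem_properDivisors hk)] at this
    exact Nat.add_right_cancel this

/-- The number of Misiurewicz points of type `(l, n)` is `Φ(l, n) ⬝ |hyp n|`, where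
`Φ(l, n) = 2^(l-1) - 1` if `n ∣ l - 1` and `Φ(l, n) = 2^(l-1)` otherwise. -/
theorem mis_card (l n : ℕ) (hl : 2 ≤ l) (hn : 1 ≤ n) :
    (mis l n).ncard =
      (if n ∣ l - 1 then 2 ^ (l - 1) - 1 else 2 ^ (l - 1)) * (hyp n).ncard := by
  obtain ⟨l, rfl⟩ := Nat.exists_eq_add_of_le' (show 1 ≤ l by omega)
  have key := eq_of_sum_divisors_eq
    (F := fun k => (mis (l + 1) k).ncard + if k ∣ l then (hyp k).ncard else 0)
    (G := fun k => 2 ^ l * (hyp k).ncard) (fun m hm => by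
      rw [sum_divisors_ncard_mis (by omega) hm, ← Finset.mul_sum, sum_divisors_ncard_hyp hm,
        ← pow_add, Nat.add_sub_assoc hm]) n hn
  rw [Nat.add_sub_cancel]
  split_ifs with h <;> simp only [h, if_true, if_false] at key
  · rw [Nat.sub_mul]
    omega
  · omega
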